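/- arXiv:math/0105143 — 6 statements merged into one kernel-verified Lean document; each statement's English description precedes it below -/
import Mathlib

section
/- Let φ be a flow on a compact metric space M and let Λ ⊆ M be a compact invariant set. If Λ is isolated and Lyapunov stable, then Λ is an attracting set; that is, there exists a neighborhood U of Λ such that φ^t(U) ⊆ U for every t > 0 and ⋂_{t≥0} φ^t(U) = Λ. (Lemma 2.2 of the paper: isolated Lyapunov stable sets are attracting sets.) -/
open Set Filter Topology

variable {M : Type*}

/-- The ω-limit set of a point `x` under the flow `φ`: the set of points `y` such that
`φ^{t n}(x) → y` for some sequence `t n → ∞`. -/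
def omegaPt [TopologicalSpace M] (φ : Flow ℝ M) (x : M) : Set M :=
  {y | ∃ u : ℕ → ℝ, Tendsto u atTop atTop ∧
    Tendsto (fun n => φ.toFun (u n) x) atTop (𝓝 y)}

/-- A set `S` is invariant under the flow `φ` if `φ^t(S) = S` for all `t ∈ ℝ`. -/
def IsInvariantSet [TopologicalSpace M] (φ : Flow ℝ M) (S : Set M) : Prop :=
  ∀ t : ℝ, φ.toFun t '' S = S

/-- A set `Λ` is Lyapunov stable for `φ` if every neighborhood `U` of `Λ` contains a
neighborhood `V` of `Λ` with `φ^t(V) ⊆ U` for all `t ≥ 0`. -/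
def IsLyapunovStable [TopologicalSpace M] (φ : Flow ℝ M) (Λ : Set M) : Prop :=
  ∀ U ∈ 𝓝ˢ Λ, ∃ V ∈ 𝓝ˢ Λ, V ⊆ U ∧ ∀ t : ℝ, 0 ≤ t → φ.toFun t '' V ⊆ U

/-- A set `Λ` is isolated for `φ` if it has a neighborhood `U` (an isolating block) such that
`⋂_{t ∈ ℝ} φ^t(U) = Λ`. -/
def IsIsolatedSet [TopologicalSpace M] (φ : Flow ℝ M) (Λ : Set M) : Prop :=
  ∃ U ∈ 𝓝ˢ Λ, (⋂ t : ℝ, φ.toFun t '' U) = Λ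

/-- A set `Λ` is an attracting set for `φ` if it has a neighborhood `U` with `φ^t(U) ⊆ U` for
all `t > 0` and `⋂_{t ≥ 0} φ^t(U) = Λ`. -/
def IsAttractingSet [TopologicalSpace M] (φ : Flow ℝ M) (Λ : Set M) : Prop :=
  ∃ U ∈ 𝓝ˢ Λ, (∀ t : ℝ, 0 < t → φ.toFun t '' U ⊆ U) ∧
    (⋂ t ∈ Ici (0 : ℝ), φ.toFun t '' U) = Λ

/-- A compact invariant set `Λ` is transitive if `Λ = ω(p)` for some `p ∈ Λ`. -/
def IsTransitiveSet [TopologicalSpace M] (φ : Flow ℝ M) (Λ : Set M) : Prop :=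
  IsCompact Λ ∧ IsInvariantSet φ Λ ∧ ∃ p ∈ Λ, omegaPt φ p = Λ

/-- An attractor is a transitive set which is an attracting set. -/
def IsAttractor [TopologicalSpace M] (φ : Flow ℝ M) (Λ : Set M) : Prop :=
  IsTransitiveSet φ Λ ∧ IsAttractingSet φ Λ

/-- The nonwandering set of `φ`. -/
def nonwanderingSet [TopologicalSpace M] (φ : Flow ℝ M) : Set M :=
  {x | ∀ U ∈ 𝓝 x, ∀ T : ℝ, 0 < T → ∃ t : ℝ, T < t ∧ ((φ.toFun t '' U) ∩ U).Nonempty}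

/-- Lemma 2.2: Let `φ` be a flow on a compact metric space `M` and `Λ ⊆ M`
a compact invariant set. If `Λ` is isolated and Lyapunov stable, then `Λ` is an attracting set:
there is a neighborhood `U` of `Λ` with `φ^t(U) ⊆ U` for all `t > 0` and `⋂_{t≥0} φ^t(U) = Λ`. -/
theorem isolated_lyapunovStable_isAttractingSet
    [MetricSpace M] [CompactSpace M] (φ : Flow ℝ M) (Λ : Set M)
    (hcomp : IsCompact Λ) (hinv : IsInvariantSet φ Λ)
    (hiso : IsIsolatedSet φ Λ) (hstab : IsLyapunovStable φ Λ) :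
    IsAttractingSet φ Λ := by
  obtain ⟨U, hU, hUΛ⟩ := hiso
  obtain ⟨V, hV, -, hVU⟩ := hstab U hU
  have hmem : ∀ (S : Set M) (t : ℝ) (x : M), x ∈ φ.toFun t '' S ↔ φ.toFun (-t) x ∈ S := by
    intro S t x
    constructor
    · rintro ⟨y, hy, rfl⟩
      rwa [← φ.map_add', neg_add_cancel, φ.map_zero']
    · intro hx
      exact ⟨_, hx, by rw [← φ.map_add', add_neg_cancel, φ.map_zero']⟩
  have hWmem : {x | ∀ t : ℝ, 0 ≤ t → φ.toFun t x ∈ U} ∈ 𝓝ˢ Λ :=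
    mem_of_superset hV fun x hx t ht => hVU t ht (mem_image_of_mem _ hx)
  refine ⟨{x | ∀ t : ℝ, 0 ≤ t → φ.toFun t x ∈ U}, hWmem, ?_, Subset.antisymm ?_ ?_⟩
  · rintro t ht _ ⟨x, hx, rfl⟩ s hs
    rw [← φ.map_add']
    exact hx _ (by linarith)
  · intro x hx
    rw [← hUΛ, mem_iInter]
    intro t
    rw [hmem]
    have hback : ∀ s : ℝ, 0 ≤ s → ∀ r : ℝ, 0 ≤ r → φ.toFun r (φ.toFun (-s) x) ∈ U :=
      fun s hs => (hmem _ s x).1 (mem_iInter₂.1 hx s hs)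
    have h := hback |t| (abs_nonneg t) (|t| - t) (sub_nonneg.2 (le_abs_self t))
    rwa [← φ.map_add', show |t| - t + -|t| = -t by ring] at h
  · refine subset_iInter₂ fun t _ => ?_
    rw [← hinv t]
    exact image_mono (subset_of_mem_nhdsSet hWmem)
end

section
/- Let φ be a flow on a compact metric space M. Suppose the nonwandering set Ω(φ) equals the pairwise disjoint union {σ_1} ∪ ⋯ ∪ {σ_l} ∪ H_1 ∪ ⋯ ∪ H_m, where each σ_i is a fixed point of φ and each H_j is a compact invariant transitive set. If x ∈ M and ω(x) is Lyapunov stable, then ω(x) = {σ_i} for some i or ω(x) = H_j for some j. (The Claim in the proof of Theorem A of the paper.) -/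
open Set Filter Topology

variable {M : Type*}

theorem mem_omegaPt_iff_mapClusterPt [TopologicalSpace M] [FirstCountableTopology M]
    (φ : Flow ℝ M) (x y : M) :
    y ∈ omegaPt φ x ↔ MapClusterPt y atTop (fun t => φ.toFun t x) := by
  constructor
  · rintro ⟨u, hu, hy⟩
    exact MapClusterPt.of_comp hu hy.mapClusterPt
  · intro h
    obtain ⟨u, hy, hu⟩ := h.exists_seq_tendsto
    exact ⟨u, hu, hy⟩

theorem mem_omegaPt_iff_frequently [TopologicalSpace M] [FirstCountableTopology M]
    (φ : Flow ℝ M) (x y : M) :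
    y ∈ omegaPt φ x ↔ ∀ s ∈ 𝓝 y, ∃ᶠ t in atTop, φ.toFun t x ∈ s := by
  rw [mem_omegaPt_iff_mapClusterPt, mapClusterPt_iff_frequently]

theorem isClosed_omegaPt [TopologicalSpace M] [FirstCountableTopology M]
    (φ : Flow ℝ M) (x : M) : IsClosed (omegaPt φ x) := by
  have h : omegaPt φ x = {y | ClusterPt y (map (fun t => φ.toFun t x) atTop)} :=
    Set.ext fun y => mem_omegaPt_iff_mapClusterPt φ x y
  rw [h]
  exact isClosed_setOfPred_clusterPt

theorem omegaPt_nonempty [TopologicalSpace M] [FirstCountableTopology M] [CompactSpace M]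
    (φ : Flow ℝ M) (x : M) : (omegaPt φ x).Nonempty := by
  obtain ⟨y, hy⟩ := exists_clusterPt_of_compactSpace (map (fun t => φ.toFun t x) atTop)
  exact ⟨y, (mem_omegaPt_iff_mapClusterPt φ x y).2 hy⟩

theorem eventually_mem_of_omegaPt_subset [TopologicalSpace M] [FirstCountableTopology M]
    [CompactSpace M] (φ : Flow ℝ M) (x : M) {O : Set M} (hO : IsOpen O)
    (h : omegaPt φ x ⊆ O) : ∀ᶠ t in atTop, φ.toFun t x ∈ O := by
  by_contra hcon
  obtain ⟨y, hyO, hy⟩ := hO.isClosed_compl.isCompact.exists_mapClusterPt_of_frequently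
    (not_eventually.1 hcon)
  exact hyO (h ((mem_omegaPt_iff_mapClusterPt φ x y).2 hy))

theorem omegaPt_subset_nonwanderingSet [TopologicalSpace M] [FirstCountableTopology M]
    (φ : Flow ℝ M) (x : M) : omegaPt φ x ⊆ nonwanderingSet φ := by
  intro y hy U hU T _
  rw [mem_omegaPt_iff_frequently] at hy
  obtain ⟨s, hs⟩ := (hy U hU).exists
  obtain ⟨t, htU, ht⟩ := ((hy U hU).and_eventually (eventually_gt_atTop (s + T))).exists
  refine ⟨t - s, by linarith, φ.toFun t x, ⟨φ.toFun s x, hs, ?_⟩, htU⟩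
  rw [← φ.map_add, sub_add_cancel]

/-- In a compact space, an ω-limit set covered by two disjoint open sets lies in any one of them
that it meets. -/
theorem omegaPt_subset_left_of_subset_union [TopologicalSpace M] [FirstCountableTopology M]
    [CompactSpace M] (φ : Flow ℝ M) (x : M) {U V : Set M} (hU : IsOpen U) (hV : IsOpen V)
    (hUV : Disjoint U V) (h : omegaPt φ x ⊆ U ∪ V) (hne : (omegaPt φ x ∩ U).Nonempty) :
    omegaPt φ x ⊆ U := by
  obtain ⟨T, hT⟩ := eventually_atTop.1 (eventually_mem_of_omegaPt_subset φ x (hU.union hV) h)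
  obtain ⟨y, hy, hyU⟩ := hne
  obtain ⟨t, htU, ht⟩ := (((mem_omegaPt_iff_frequently φ x y).1 hy U
    (hU.mem_nhds hyU)).and_eventually (eventually_ge_atTop T)).exists
  have hconn : IsPreconnected ((fun t => φ.toFun t x) '' Ici T) :=
    isPreconnected_Ici.image _ (φ.continuous continuous_id continuous_const).continuousOn
  have hsub : (fun t => φ.toFun t x) '' Ici T ⊆ U :=
    hconn.subset_left_of_subset_union hU hV hUV (by rintro _ ⟨s, hs, rfl⟩; exact hT s hs)
      ⟨_, ⟨t, ht, rfl⟩, htU⟩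
  intro z hz
  refine (h hz).resolve_right fun hzV => ?_
  obtain ⟨s, hsV, hs⟩ := (((mem_omegaPt_iff_frequently φ x z).1 hz V
    (hV.mem_nhds hzV)).and_eventually (eventually_ge_atTop T)).exists
  exact hUV.le_bot ⟨hsub ⟨s, hs, rfl⟩, hsV⟩

/-- In a compact Hausdorff space, an ω-limit set covered by finitely many pairwise disjoint closed
sets lies in one of them. -/
theorem exists_omegaPt_subset_of_subset_iUnion [TopologicalSpace M] [FirstCountableTopology M]
    [CompactSpace M] [T2Space M] (φ : Flow ℝ M) (x : M) {ι : Type*} [Finite ι] (K : ι → Set M)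
    (hK : ∀ i, IsClosed (K i)) (hdisj : Pairwise (Function.onFun Disjoint K))
    (h : omegaPt φ x ⊆ ⋃ i, K i) : ∃ i, omegaPt φ x ⊆ K i := by
  obtain ⟨y, hy⟩ := omegaPt_nonempty φ x
  obtain ⟨i, hi⟩ := mem_iUnion.1 (h hy)
  have hB : IsClosed (⋃ k : {k // k ≠ i}, K k) := isClosed_iUnion_of_finite fun k => hK k
  have hAB : Disjoint (K i) (⋃ k : {k // k ≠ i}, K k) :=
    disjoint_iUnion_right.2 fun k => hdisj k.2.symm
  obtain ⟨U, V, hU, hV, hAU, hBV, hUV⟩ :=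
    SeparatedNhds.of_isCompact_isCompact (hK i).isCompact hB.isCompact hAB
  have hcover : ∀ z ∈ omegaPt φ x, z ∈ K i ∨ z ∈ V := by
    intro z hz
    obtain ⟨k, hk⟩ := mem_iUnion.1 (h hz)
    by_cases hki : k = i
    · exact Or.inl (hki ▸ hk)
    · exact Or.inr (hBV (mem_iUnion.2 ⟨⟨k, hki⟩, hk⟩))
  have hsub : omegaPt φ x ⊆ U := omegaPt_subset_left_of_subset_union φ x hU hV hUV
    (fun z hz => (hcover z hz).imp (@hAU z) id) ⟨y, hy, hAU hi⟩
  exact ⟨i, fun z hz => (hcover z hz).resolve_right fun hzV => hUV.le_bot ⟨hsub hz, hzV⟩⟩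

/-- If the ω-limit set of `p` meets a closed Lyapunov stable set, it is contained in it. -/
theorem omegaPt_subset_of_isLyapunovStable [TopologicalSpace M] [FirstCountableTopology M]
    [RegularSpace M] (φ : Flow ℝ M) (p : M) {Λ : Set M} (hΛ : IsClosed Λ)
    (hstab : IsLyapunovStable φ Λ) (hne : (omegaPt φ p ∩ Λ).Nonempty) : omegaPt φ p ⊆ Λ := by
  intro y hy
  by_contra hyΛ
  obtain ⟨U, hU, W, hW, hUW⟩ := Filter.disjoint_iff.1
    (RegularSpace.regular hΛ hyΛ)
  obtain ⟨V, hV, -, hVU⟩ := hstab U hU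
  obtain ⟨z, hzp, hz⟩ := hne
  obtain ⟨s, hs⟩ := ((mem_omegaPt_iff_frequently φ p z).1 hzp V
    (mem_nhdsSet_iff_forall.1 hV z hz)).exists
  obtain ⟨t, htW, ht⟩ := (((mem_omegaPt_iff_frequently φ p y).1 hy W hW).and_eventually
    (eventually_ge_atTop s)).exists
  refine hUW.le_bot ⟨hVU (t - s) (by linarith) ⟨φ.toFun s p, hs, ?_⟩, htW⟩
  rw [← φ.map_add, sub_add_cancel]

/-- the Claim in Section 2: Suppose the nonwandering set of a flow `φ`
on a compact metric space is the pairwise disjoint union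
`{σ 1} ∪ ⋯ ∪ {σ l} ∪ H 1 ∪ ⋯ ∪ H m`, where each `σ i` is a fixed point and each `H j`
is a compact invariant transitive set. If `x ∈ M` and `ω(x)` is Lyapunov stable, then
`ω(x) = {σ i}` for some `i` or `ω(x) = H j` for some `j`. -/
theorem omegaPt_eq_sing_or_eq_class_of_lyapunovStable
    [MetricSpace M] [CompactSpace M] (φ : Flow ℝ M)
    {l m : ℕ} (σ : Fin l → M) (H : Fin m → Set M)
    (hσfix : ∀ i, ∀ t : ℝ, φ.toFun t (σ i) = σ i)
    (hHcomp : ∀ j, IsCompact (H j))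
    (hHinv : ∀ j, IsInvariantSet φ (H j))
    (hHtrans : ∀ j, ∃ p ∈ H j, omegaPt φ p = H j)
    (hσinj : Function.Injective σ)
    (hσH : ∀ i j, σ i ∉ H j)
    (hHdisj : ∀ j j', j ≠ j' → Disjoint (H j) (H j'))
    (hΩ : nonwanderingSet φ = (⋃ i, {σ i}) ∪ ⋃ j, H j)
    (x : M) (hx : IsLyapunovStable φ (omegaPt φ x)) :
    (∃ i, omegaPt φ x = {σ i}) ∨ (∃ j, omegaPt φ x = H j) := by
  have hcover : omegaPt φ x ⊆ ⋃ k, Sum.elim (fun i => {σ i}) H k := by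
    rw [iUnion_sum]
    exact (omegaPt_subset_nonwanderingSet φ x).trans hΩ.subset
  obtain ⟨i | j, hk⟩ := exists_omegaPt_subset_of_subset_iUnion φ x
    (Sum.elim (fun i => {σ i}) H)
    (by
      rintro (i | j)
      · exact isClosed_singleton
      · exact (hHcomp j).isClosed)
    (by
      rintro (i | i) (j | j) hij
      · exact disjoint_singleton.2 fun h => hij (congrArg Sum.inl (hσinj h))
      · exact disjoint_singleton_left.2 (hσH i j)
      · exact disjoint_singleton_right.2 (hσH j i)
      · exact hHdisj i j fun h => hij (congrArg Sum.inr h))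
    hcover
  · exact Or.inl ⟨i, (omegaPt_nonempty φ x).subset_singleton_iff.1 hk⟩
  · refine Or.inr ⟨j, hk.antisymm ?_⟩
    obtain ⟨p, -, hp⟩ := hHtrans j
    obtain ⟨z, hz⟩ := omegaPt_nonempty φ x
    have hzp : z ∈ omegaPt φ p := hp ▸ hk hz
    exact hp.symm.subset.trans <|
      omegaPt_subset_of_isLyapunovStable φ p (isClosed_omegaPt φ x) hx ⟨z, hzp, hz⟩
end

section
/- Let φ be a flow on a compact metric space M and let Λ ⊆ M be a compact set. Then Λ is an attractor of φ (a transitive set which admits a neighborhood U with φ^t(U) ⊆ U for all t > 0 and ⋂_{t≥0} φ^t(U) = Λ) if and only if Λ is transitive, isolated, and Lyapunov stable. (Combination of Lemma 2.2 and its converse as stated in the paper.) -/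
open Set Filter Topology

variable {M : Type*}

theorem mem_image_toFun_iff [TopologicalSpace M] (φ : Flow ℝ M) (t : ℝ) (S : Set M) (x : M) :
    x ∈ φ.toFun t '' S ↔ φ (-t) x ∈ S := by
  rw [φ.image_eq_preimage_symm, mem_preimage]

theorem IsInvariantSet.apply_mem [TopologicalSpace M] {φ : Flow ℝ M} {S : Set M}
    (hS : IsInvariantSet φ S) {x : M} (hx : x ∈ S) (t : ℝ) : φ t x ∈ S := by
  have h : φ t x ∈ φ.toFun t '' S := mem_image_of_mem _ hx
  rwa [hS t] at h

theorem IsAttractingSet.isIsolatedSet [TopologicalSpace M] {φ : Flow ℝ M} {Λ : Set M}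
    (hinv : IsInvariantSet φ Λ) (h : IsAttractingSet φ Λ) : IsIsolatedSet φ Λ := by
  obtain ⟨U, hU, -, hΛ⟩ := h
  refine ⟨U, hU, Subset.antisymm ?_ ?_⟩
  · exact (subset_iInter₂ fun t _ => iInter_subset _ t).trans hΛ.subset
  · refine fun x hx => mem_iInter.2 fun t => ?_
    rw [mem_image_toFun_iff]
    exact subset_of_mem_nhdsSet hU (hinv.apply_mem hx _)

/-- If a compact set `K` contains no full backward orbit outside `Λ ⊆ interior K`, then points
near `Λ` never leave `K` in forward time. -/
theorem exists_nhdsSet_forall_nonneg_mem [TopologicalSpace M] [T2Space M] [CompactSpace M]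
    {φ : Flow ℝ M} {Λ K : Set M} (hinv : IsInvariantSet φ Λ) (hK : IsClosed K)
    (hΛK : Λ ⊆ interior K) (hback : ∀ x, (∀ s : ℝ, 0 ≤ s → φ (-s) x ∈ K) → x ∈ Λ) :
    ∃ V ∈ 𝓝ˢ Λ, ∀ x ∈ V, ∀ t : ℝ, 0 ≤ t → φ t x ∈ K := by
  obtain ⟨T, hT⟩ : ∃ T : ℕ, ∀ x, (∀ s ∈ Icc (0 : ℝ) T, φ (-s) x ∈ K) → x ∈ interior K := by
    let A : ℕ → Set M := fun n => ⋂ s ∈ Icc (0 : ℝ) n, φ (-s) ⁻¹' K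
    have hA : Antitone A := fun m n hmn =>
      biInter_subset_biInter_left (Icc_subset_Icc_right (Nat.cast_le.2 hmn))
    have hAc (n : ℕ) : IsClosed (A n) :=
      isClosed_biInter fun s _ => hK.preimage (φ.continuous_toFun (-s))
    obtain ⟨n, hn⟩ := exists_subset_nhds_of_compactSpace (directed_of_isDirected_le hA) hAc
      (U := interior K) fun x hx => isOpen_interior.mem_nhds <| hΛK <| hback x fun s hs => by
        obtain ⟨n, hn⟩ := exists_nat_ge s
        exact mem_iInter₂.1 (mem_iInter.1 hx n) s ⟨hs, hn⟩
    exact ⟨n, fun x hx => hn (mem_iInter₂.2 hx)⟩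
  refine ⟨{x | ∀ s ∈ Icc (0 : ℝ) T, φ s x ∈ interior K}, ?_, fun x hx t ht => ?_⟩
  · rw [mem_nhdsSet_iff_forall]
    intro x hx
    refine isCompact_Icc.eventually_forall_of_forall_eventually fun s _ => ?_
    exact (φ.continuous continuous_snd continuous_fst).continuousAt.eventually_mem
      (isOpen_interior.mem_nhds (hΛK (hinv.apply_mem hx s)))
  by_contra hxt
  let E : Set ℝ := Ici 0 ∩ (fun s => φ s x) ⁻¹' (interior K)ᶜ
  have hcont : Continuous fun s : ℝ => φ s x := φ.continuous continuous_id continuous_const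
  have hEc : IsClosed E := isClosed_Ici.inter (isOpen_interior.isClosed_compl.preimage hcont)
  have hEb : BddBelow E := ⟨0, fun s hs => hs.1⟩
  have hτ : sInf E ∈ E := hEc.csInf_mem ⟨t, ht, fun h => hxt (interior_subset h)⟩ hEb
  set τ := sInf E
  have hTτ : (T : ℝ) < τ := lt_of_not_ge fun h => hτ.2 (hx τ ⟨hτ.1, h⟩)
  have hτ0 : 0 < τ := T.cast_nonneg.trans_lt hTτ
  have hlt : ∀ s ∈ Ico 0 τ, φ s x ∈ K := fun s hs => interior_subset <| by
    by_contra h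
    exact (csInf_le hEb ⟨hs.1, h⟩).not_gt hs.2
  have hle : ∀ s ∈ Icc 0 τ, φ s x ∈ K := by
    rw [← closure_Ico hτ0.ne]
    exact closure_minimal hlt (hK.preimage hcont)
  refine hτ.2 (hT _ fun s hs => ?_)
  rw [← φ.map_add]
  exact hle _ ⟨by linarith [hs.2], by linarith [hs.1]⟩

theorem IsAttractingSet.isLyapunovStable [TopologicalSpace M] [T2Space M] [CompactSpace M]
    {φ : Flow ℝ M} {Λ : Set M} (hcomp : IsCompact Λ) (hinv : IsInvariantSet φ Λ)
    (h : IsAttractingSet φ Λ) : IsLyapunovStable φ Λ := by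
  obtain ⟨U, hU, -, hΛ⟩ := h
  intro O hO
  obtain ⟨K, hK, hΛK, hKUO⟩ := exists_compact_between hcomp isOpen_interior
    (subset_interior_iff_mem_nhdsSet.2 (inter_mem hU hO))
  replace hKUO := hKUO.trans interior_subset
  obtain ⟨V, hV, hVK⟩ := exists_nhdsSet_forall_nonneg_mem hinv hK.isClosed hΛK fun x hx => by
    rw [← hΛ]
    exact mem_iInter₂.2 fun t ht => (mem_image_toFun_iff φ t U x).2 (hKUO (hx t ht)).1
  refine ⟨V, hV, fun x hx => (hKUO ?_).2, ?_⟩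
  · simpa using hVK x hx 0 le_rfl
  · rintro t ht _ ⟨x, hx, rfl⟩
    exact (hKUO (hVK x hx t ht)).2

theorem IsIsolatedSet.isAttractingSet [TopologicalSpace M] {φ : Flow ℝ M} {Λ : Set M}
    (hinv : IsInvariantSet φ Λ) (hiso : IsIsolatedSet φ Λ) (hstab : IsLyapunovStable φ Λ) :
    IsAttractingSet φ Λ := by
  obtain ⟨U, hU, hΛ⟩ := hiso
  obtain ⟨V, hV, -, hVU⟩ := hstab U hU
  let W : Set M := {y | ∃ x ∈ V, ∃ s : ℝ, 0 ≤ s ∧ φ s x = y}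
  have hVW : V ⊆ W := fun x hx => ⟨x, hx, 0, le_rfl, φ.map_zero_apply x⟩
  have hWU : W ⊆ U := by
    rintro _ ⟨x, hx, s, hs, rfl⟩
    exact hVU s hs (mem_image_of_mem _ hx)
  have hW {t : ℝ} (ht : 0 ≤ t) {y : M} (hy : y ∈ W) : φ t y ∈ W := by
    obtain ⟨x, hx, s, hs, rfl⟩ := hy
    exact ⟨x, hx, t + s, add_nonneg ht hs, φ.map_add t s x⟩
  refine ⟨W, mem_of_superset hV hVW, ?_, Subset.antisymm (fun x hx => ?_) fun x hx => ?_⟩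
  · rintro t ht _ ⟨y, hy, rfl⟩
    exact hW ht.le hy
  · have hxW (t : ℝ) (ht : 0 ≤ t) : φ (-t) x ∈ W :=
      (mem_image_toFun_iff φ t W x).1 (mem_iInter₂.1 hx t ht)
    have hx0 : x ∈ W := by simpa using hxW 0 le_rfl
    rw [← hΛ]
    refine mem_iInter.2 fun t => (mem_image_toFun_iff φ t U x).2 (hWU ?_)
    rcases le_total 0 t with ht | ht
    · exact hxW t ht
    · exact hW (neg_nonneg.2 ht) hx0
  · exact mem_iInter₂.2 fun t _ => (mem_image_toFun_iff φ t W x).2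
      (hVW (subset_of_mem_nhdsSet hV (hinv.apply_mem hx _)))

/-- A compact set `Λ` of a flow `φ` on a compact metric space is an attractor
(a transitive set admitting a neighborhood `U` with `φ^t(U) ⊆ U` for all `t > 0` and
`⋂_{t ≥ 0} φ^t(U) = Λ`) if and only if `Λ` is transitive, isolated, and Lyapunov stable. -/
theorem isAttractor_iff_transitive_isolated_lyapunovStable
    [MetricSpace M] [CompactSpace M] (φ : Flow ℝ M) (Λ : Set M)
    (hcomp : IsCompact Λ) :
    IsAttractor φ Λ ↔
      IsTransitiveSet φ Λ ∧ IsIsolatedSet φ Λ ∧ IsLyapunovStable φ Λ := by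
  exact ⟨fun ⟨ht, ha⟩ => ⟨ht, ha.isIsolatedSet ht.2.1, ha.isLyapunovStable hcomp ht.2.1⟩,
    fun ⟨ht, hi, hs⟩ => ⟨ht, hi.isAttractingSet ht.2.1 hs⟩⟩
end

section
/- Let φ be a flow on a compact metric space M. Suppose the nonwandering set Ω(φ) equals the pairwise disjoint union {σ_1} ∪ ⋯ ∪ {σ_l} ∪ H_1 ∪ ⋯ ∪ H_m, where each σ_i is a fixed point of φ and each H_j is a compact invariant transitive set. Then every attractor of φ equals {σ_i} for some i or H_j for some j; in particular, φ has at most l + m attractors. (Finitude of attractors, from the proof of Theorem A.) -/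
open Set Filter Topology

variable {M : Type*}

namespace Flow

theorem continuous_time {X : Type*} [TopologicalSpace X] (φ : Flow ℝ X) (x : X) :
    Continuous fun t => φ t x :=
  φ.continuous continuous_id continuous_const

/-- The points whose backward orbit up to time `T` lies in `K`. -/
def backwardTrapped {X : Type*} [TopologicalSpace X] (φ : Flow ℝ X) (K : Set X) (T : ℝ) : Set X :=
  {x | ∀ t ∈ Icc 0 T, φ (-t) x ∈ K}

theorem isClosed_backwardTrapped {X : Type*} [TopologicalSpace X] (φ : Flow ℝ X) {K : Set X}
    (hK : IsClosed K) (T : ℝ) : IsClosed (φ.backwardTrapped K T) := by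
  simp only [backwardTrapped, ofPred_forall]
  exact isClosed_biInter fun t _ => hK.preimage (φ.continuous_toFun (-t))

/-- If every point trapped backward in `K` up to time `T` is interior to `K`, then an orbit which
stays in `K` during a time interval of length `T` stays in `K` forever after. -/
theorem mem_of_backwardTrapped_subset_interior {X : Type*} [TopologicalSpace X] (φ : Flow ℝ X)
    {K : Set X} (hK : IsClosed K) {T : ℝ} (hT : 0 ≤ T)
    (hB : φ.backwardTrapped K T ⊆ interior K) {z : X} (hz : z ∈ φ.backwardTrapped K T)
    {s : ℝ} (hs : 0 ≤ s) : φ s z ∈ K := by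
  have hclosed : IsClosed ({r | φ r z ∈ φ.backwardTrapped K T} ∩ Icc 0 s) :=
    ((φ.isClosed_backwardTrapped hK T).preimage (φ.continuous_time z)).inter isClosed_Icc
  have h := hclosed.Icc_subset_of_forall_exists_gt (by simpa using hz) ?_ (right_mem_Icc.2 hs)
  · simpa using h 0 ⟨le_rfl, hT⟩
  rintro r ⟨hr, -⟩ y hy
  have hnhds : ∀ᶠ r' in 𝓝 r, φ r' z ∈ K :=
    (φ.continuous_time z).continuousAt.eventually (mem_interior_iff_mem_nhds.1 (hB hr))
  obtain ⟨ε, hε, hball⟩ := Metric.eventually_nhds_iff.1 hnhds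
  have hy' : r < y := hy
  refine ⟨min y (r + ε / 2), fun t ht => ?_, lt_min hy' (by linarith), min_le_left _ _⟩
  have hle := min_le_right y (r + ε / 2)
  have hlt : r < min y (r + ε / 2) := lt_min hy' (by linarith)
  rw [← φ.map_add]
  rcases le_or_gt (-t + min y (r + ε / 2)) r with h | h
  · have := hr (r - (-t + min y (r + ε / 2))) ⟨by linarith, by linarith [ht.2]⟩
    rw [← φ.map_add] at this
    convert this using 2
    ring
  · apply hball
    rw [Real.dist_eq, abs_of_pos (by linarith)]
    linarith [ht.1]

end Flow

theorem mem_nonwanderingSet_of_mem_omegaPt [TopologicalSpace M] {φ : Flow ℝ M} {p : M}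
    (hp : p ∈ omegaPt φ p) : p ∈ nonwanderingSet φ := by
  obtain ⟨u, hu, hup⟩ := hp
  intro U hU T _
  obtain ⟨n, hn, hT⟩ := ((hup.eventually hU).and (hu.eventually_gt_atTop T)).exists
  exact ⟨u n, hT, _, mem_image_of_mem _ (mem_of_mem_nhds hU), hn⟩

theorem omegaPt_subset [TopologicalSpace M] {φ : Flow ℝ M} {S : Set M} (hS : IsClosed S)
    (hinv : IsInvariantSet φ S) {x : M} (hx : x ∈ S) : omegaPt φ x ⊆ S := by
  rintro y ⟨u, -, hu⟩
  exact hS.mem_of_tendsto hu (.of_forall fun n => hinv (u n) ▸ mem_image_of_mem _ hx)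

/-- If an orbit eventually stays in a closed set, so do all translates of its limit points. -/
theorem flow_mem_of_mem_omegaPt [TopologicalSpace M] {φ : Flow ℝ M} {K : Set M}
    (hK : IsClosed K) {q y : M} {s : ℝ} (hq : ∀ r, s ≤ r → φ r q ∈ K) (hy : y ∈ omegaPt φ q)
    (t : ℝ) : φ t y ∈ K := by
  obtain ⟨u, hu, huy⟩ := hy
  refine hK.mem_of_tendsto (((φ.continuous_toFun t).tendsto y).comp huy) ?_
  filter_upwards [hu.eventually_ge_atTop (s - t)] with n hn
  have := hq (t + u n) (by linarith)
  rwa [φ.map_add] at this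

/-- An attracting set which meets the ω-limit set of a point contains it. -/
theorem IsAttractingSet.omegaPt_subset [TopologicalSpace M] [CompactSpace M] [T2Space M]
    {φ : Flow ℝ M} {Λ : Set M} (hΛ : IsAttractingSet φ Λ) (hcomp : IsCompact Λ)
    (hinv : IsInvariantSet φ Λ) {p q : M} (hp : p ∈ Λ) (hpq : p ∈ omegaPt φ q) :
    omegaPt φ q ⊆ Λ := by
  obtain ⟨U, hU, -, hUΛ⟩ := hΛ
  obtain ⟨V, hVo, hΛV, hVU⟩ := hcomp.exists_isOpen_closure_subset hU
  have hKΛ : ∀ x, (∀ t, 0 ≤ t → φ (-t) x ∈ closure V) → x ∈ Λ := by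
    intro x hx
    rw [← hUΛ]
    refine mem_iInter₂.2 fun t ht => ⟨φ (-t) x, hVU (hx t ht), ?_⟩
    rw [← φ.map_add, add_neg_cancel, φ.map_zero_apply]
  obtain ⟨T, hT⟩ : ∃ T : Ici (0 : ℝ), φ.backwardTrapped (closure V) T ⊆ interior (closure V) := by
    refine exists_subset_nhds_of_compactSpace
      (V := fun T : Ici (0 : ℝ) => φ.backwardTrapped (closure V) T) (Antitone.directed_ge ?_)
      (fun T => φ.isClosed_backwardTrapped isClosed_closure T) fun x hx => ?_
    · exact fun a b hab x hx t ht => hx t ⟨ht.1, ht.2.trans hab⟩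
    · refine isOpen_interior.mem_nhds (interior_maximal subset_closure hVo (hΛV (hKΛ x ?_)))
      exact fun t ht => mem_iInter.1 hx ⟨t, ht⟩ t ⟨ht, le_rfl⟩
  have hpV : ∀ᶠ x in 𝓝 p, ∀ t ∈ Icc 0 (T : ℝ), φ t x ∈ V := by
    refine isCompact_Icc.eventually_forall_of_forall_eventually fun t _ => ?_
    refine (φ.cont'.comp continuous_swap).continuousAt.eventually (hVo.mem_nhds (hΛV ?_))
    exact hinv t ▸ mem_image_of_mem _ hp
  obtain ⟨u, -, hu⟩ := hpq
  obtain ⟨n, hn⟩ := (hu.eventually hpV).exists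
  have hz : φ (T + u n) q ∈ φ.backwardTrapped (closure V) T := by
    intro t ht
    have := hn (T - t) ⟨by linarith [ht.2], by linarith [ht.1]⟩
    change φ (T - t) (φ (u n) q) ∈ V at this
    rw [← φ.map_add] at this ⊢
    convert subset_closure this using 2
    ring
  intro y hy
  refine hKΛ y fun t _ => flow_mem_of_mem_omegaPt isClosed_closure (s := T + u n) ?_ hy (-t)
  intro r hr
  have := φ.mem_of_backwardTrapped_subset_interior isClosed_closure T.2 hT hz
    (sub_nonneg.2 hr)
  rwa [← φ.map_add, sub_add_cancel] at this

/-- finitude of attractors: Suppose the nonwandering set of a flow `φ`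
on a compact metric space is the pairwise disjoint union
`{σ 1} ∪ ⋯ ∪ {σ l} ∪ H 1 ∪ ⋯ ∪ H m`, where each `σ i` is a fixed point and each `H j` is a
compact invariant transitive set. Then every attractor of `φ` equals `{σ i}` for some `i` or
`H j` for some `j`; in particular, `φ` has at most `l + m` attractors. -/
theorem attractor_eq_piece_and_finitely_many
    [MetricSpace M] [CompactSpace M] (φ : Flow ℝ M)
    {l m : ℕ} (σ : Fin l → M) (H : Fin m → Set M)
    (hσfix : ∀ i, ∀ t : ℝ, φ.toFun t (σ i) = σ i)
    (hHcomp : ∀ j, IsCompact (H j))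
    (hHinv : ∀ j, IsInvariantSet φ (H j))
    (hHtrans : ∀ j, ∃ p ∈ H j, omegaPt φ p = H j)
    (hσinj : Function.Injective σ)
    (hσH : ∀ i j, σ i ∉ H j)
    (hHdisj : ∀ j j', j ≠ j' → Disjoint (H j) (H j'))
    (hΩ : nonwanderingSet φ = (⋃ i, {σ i}) ∪ ⋃ j, H j) :
    (∀ Λ : Set M, IsAttractor φ Λ → (∃ i, Λ = {σ i}) ∨ (∃ j, Λ = H j)) ∧
    {Λ : Set M | IsAttractor φ Λ}.Finite ∧
    {Λ : Set M | IsAttractor φ Λ}.ncard ≤ l + m := by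
  have hpiece : ∀ Λ : Set M, IsAttractor φ Λ → (∃ i, Λ = {σ i}) ∨ (∃ j, Λ = H j) := by
    rintro Λ ⟨⟨hcomp, hinv, p, hp, hpΛ⟩, hattr⟩
    have hpΩ : p ∈ nonwanderingSet φ := mem_nonwanderingSet_of_mem_omegaPt (hpΛ.symm ▸ hp)
    rw [hΩ] at hpΩ
    rcases hpΩ with h | h
    · obtain ⟨i, rfl⟩ := mem_iUnion.1 h
      refine .inl ⟨i, (hpΛ ▸ omegaPt_subset isClosed_singleton ?_ rfl).antisymm
        (singleton_subset_iff.2 hp)⟩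
      intro t
      rw [image_singleton, hσfix]
    · obtain ⟨j, hj⟩ := mem_iUnion.1 h
      obtain ⟨q, -, hqH⟩ := hHtrans j
      refine .inr ⟨j, (hpΛ ▸ omegaPt_subset (hHcomp j).isClosed (hHinv j) hj).antisymm ?_⟩
      exact hqH ▸ hattr.omegaPt_subset hcomp hinv hp (hqH.symm ▸ hj)
  have hsub : {Λ : Set M | IsAttractor φ Λ} ⊆ range (Sum.elim (fun i => {σ i}) H) := by
    intro Λ hΛ
    rcases hpiece Λ hΛ with ⟨i, rfl⟩ | ⟨j, rfl⟩
    · exact ⟨.inl i, rfl⟩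
    · exact ⟨.inr j, rfl⟩
  refine ⟨hpiece, (finite_range _).subset hsub, (ncard_le_ncard hsub (finite_range _)).trans ?_⟩
  rw [← image_univ]
  exact (ncard_image_le finite_univ).trans (by simp [ncard_univ])
end

section
/- Let f be a homeomorphism of a compact metric space M and let Λ ⊆ M be a compact set with f(Λ) = Λ. If Λ is isolated (some neighborhood U satisfies ⋂_{n∈ℤ} f^n(U) = Λ) and Lyapunov stable, then Λ is an attracting set: there exists a neighborhood U of Λ with f(U) ⊆ U and ⋂_{n≥0} f^n(U) = Λ. (Discrete-time version of Lemma 2.2, which the paper remarks holds for diffeomorphisms.) -/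
open Set Filter Topology

variable {M : Type*}

/-- A compact invariant set `Λ` of a homeomorphism `f` is Lyapunov stable if every
neighborhood `U` of `Λ` contains a neighborhood `V` of `Λ` with `f^n(V) ⊆ U` for all
`n ≥ 0`. -/
def IsLyapunovStableMap [TopologicalSpace M] (f : M ≃ₜ M) (Λ : Set M) : Prop :=
  ∀ U ∈ 𝓝ˢ Λ, ∃ V ∈ 𝓝ˢ Λ, V ⊆ U ∧ ∀ n : ℕ, (⇑f)^[n] '' V ⊆ U

/-- `Λ` is isolated for the homeomorphism `f` if it has a neighborhood `U` with
`⋂_{n ∈ ℤ} f^n(U) = Λ`. -/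
def IsIsolatedSetMap [TopologicalSpace M] (f : M ≃ₜ M) (Λ : Set M) : Prop :=
  ∃ U ∈ 𝓝ˢ Λ, (⋂ n : ℤ, ⇑(f.toEquiv ^ n) '' U) = Λ

/-- discrete-time Lemma 2.2: Let `f` be a homeomorphism of a compact
metric space `M` and `Λ` a compact set with `f(Λ) = Λ`. If `Λ` is isolated and Lyapunov
stable, then `Λ` is an attracting set: there is a neighborhood `U` of `Λ` with `f(U) ⊆ U`
and `⋂_{n ≥ 0} f^n(U) = Λ`. -/
theorem isolated_lyapunovStable_isAttractingSet_map
    [MetricSpace M] [CompactSpace M] (f : M ≃ₜ M) (Λ : Set M)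
    (hcomp : IsCompact Λ) (hinv : ⇑f '' Λ = Λ)
    (hiso : IsIsolatedSetMap f Λ) (hstab : IsLyapunovStableMap f Λ) :
    ∃ U ∈ 𝓝ˢ Λ, ⇑f '' U ⊆ U ∧ (⋂ n : ℕ, (⇑f)^[n] '' U) = Λ := by
  obtain ⟨U, hU, hUΛ⟩ := hiso
  obtain ⟨V, hV, -, hVU⟩ := hstab U hU
  have hpow (k : ℕ) (y : M) : (f.toEquiv ^ k : Equiv.Perm M) y = (⇑f)^[k] y := by
    rw [Equiv.Perm.coe_pow]
    rfl
  have hWU : (⋃ n : ℕ, (⇑f)^[n] '' V) ⊆ U := iUnion_subset hVU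
  have hVW : V ⊆ ⋃ n : ℕ, (⇑f)^[n] '' V := fun x hx => mem_iUnion.2 ⟨0, x, hx, rfl⟩
  have hfW : MapsTo f (⋃ n : ℕ, (⇑f)^[n] '' V) (⋃ n : ℕ, (⇑f)^[n] '' V) := by
    intro x hx
    obtain ⟨n, y, hy, rfl⟩ := mem_iUnion.1 hx
    exact mem_iUnion.2 ⟨n + 1, y, hy, Function.iterate_succ_apply' f n y⟩
  refine ⟨⋃ n : ℕ, (⇑f)^[n] '' V, mem_of_superset hV hVW, hfW.image_subset, ?_⟩
  apply Subset.antisymm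
  · intro x hx
    rw [mem_iInter] at hx
    rw [← hUΛ, mem_iInter]
    rintro (k | k)
    · obtain ⟨y, hy, rfl⟩ := hx k
      exact ⟨y, hWU hy, by simpa using hpow k y⟩
    · obtain ⟨y, hy, rfl⟩ := hx 0
      refine ⟨(⇑f)^[k + 1] y, hWU (hfW.iterate (k + 1) hy), ?_⟩
      rw [zpow_negSucc, ← hpow]
      exact Equiv.symm_apply_apply _ _
  · intro x hx
    rw [mem_iInter]
    intro n
    have hΛn : (⇑f)^[n] '' Λ = Λ := by
      rw [image_iterate_eq]
      exact Function.iterate_fixed hinv n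
    rw [← hΛn] at hx
    exact image_mono ((subset_of_mem_nhdsSet hV).trans hVW) hx
end

section
/- Let f be a homeomorphism of a metric space M and let Λ ⊆ M be a compact Lyapunov stable set with f(Λ) = Λ. If x ∈ M and the ω-limit set ω_f(x) intersects Λ, then ω_f(x) ⊆ Λ. (Discrete-time version of the stability absorption lemma used in the proof of the Claim.) -/
open Set Filter Topology

variable {M : Type*}

/-- The ω-limit set of a point `x` under a map `f`: the set of points `y` such that
`f^{n k}(x) → y` for some sequence of natural numbers `n k → ∞`. -/
def omegaPtMap [TopologicalSpace M] (f : M → M) (x : M) : Set M :=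
  {y | ∃ u : ℕ → ℕ, Tendsto u atTop atTop ∧
    Tendsto (fun k => f^[u k] x) atTop (𝓝 y)}

/-- discrete-time stability absorption: Let `f` be a homeomorphism of a
metric space `M` and `Λ` a compact Lyapunov stable set with `f(Λ) = Λ`. If `x ∈ M` and
the ω-limit set `ω_f(x)` intersects `Λ`, then `ω_f(x) ⊆ Λ`. -/
theorem omegaPtMap_subset_of_lyapunovStable_of_inter
    [MetricSpace M] (f : M ≃ₜ M) (Λ : Set M)
    (hcomp : IsCompact Λ) (hinv : ⇑f '' Λ = Λ)
    (hstab : IsLyapunovStableMap f Λ)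
    (x : M) (hx : (omegaPtMap (⇑f) x ∩ Λ).Nonempty) :
    omegaPtMap (⇑f) x ⊆ Λ := by
  intro y hy
  by_contra hyΛ
  obtain ⟨z, ⟨u, -, hz⟩, hzΛ⟩ := hx
  obtain ⟨v, hv, hvy⟩ := hy
  obtain ⟨U, W, hUo, hWo, hΛU, hyW, hUW⟩ :=
    hcomp.separation_of_notMem hyΛ
  obtain ⟨V, hV, -, hVU⟩ := hstab U (hUo.mem_nhdsSet.2 hΛU)
  obtain ⟨k, hk⟩ := (hz.eventually_mem (mem_nhdsSet_iff_forall.1 hV z hzΛ)).exists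
  obtain ⟨j, hj, hjW⟩ :=
    ((hv.eventually_ge_atTop (u k)).and (hvy.eventually_mem (hWo.mem_nhds hyW))).exists
  refine Set.disjoint_left.1 hUW (hVU (v j - u k) ⟨_, hk, ?_⟩) hjW
  rw [← Function.iterate_add_apply, Nat.sub_add_cancel hj]
end
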